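/- arXiv:2505.22158 — 5 statements merged into one kernel-verified Lean document; each statement's English description precedes it below -/
import Mathlib

section
/- Let q be a prime number, n ≥ 1, x ∈ (ℤ/qℤ)^n with x ≠ 0, and x′ = λx for some λ ∈ ℤ/qℤ with λ ∉ {0, 1}. Let k be uniformly distributed on (ℤ/qℤ)^n. Then the Pearson χ² divergence satisfies √( Σ_{y,y′ ∈ ℤ/qℤ} ( P[⟨k,x⟩ = y and ⟨k,x′⟩ = y′] − q^{−2} )² · q² ) ≤ √(q+1). -/
open Finset

/-- The fibres of a nonzero linear form on `K ^ ι`, with `K` a finite field, all have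
`|K| ^ |ι| / |K|` elements. -/
theorem card_fiber_sum_mul {K ι : Type*} [Field K] [Fintype K] [DecidableEq K]
    [Fintype ι] [DecidableEq ι] {x : ι → K} (hx : x ≠ 0) (y : K) :
    (univ.filter fun k : ι → K => ∑ j, k j * x j = y).card * Fintype.card K
      = Fintype.card K ^ Fintype.card ι := by
  obtain ⟨i, hi⟩ := Function.ne_iff.mp hx
  let f : (ι → K) →+ K :=
    AddMonoidHom.mk' (fun k => ∑ j, k j * x j) fun a b => by
      simp [add_mul, sum_add_distrib]
  have hf : Function.Surjective f := fun z =>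
    ⟨Pi.single i (z / x i), by simpa [f, Pi.single_apply] using div_mul_cancel₀ z hi⟩
  have hfib (z : K) : (univ.filter fun k => f k = z).card = (univ.filter fun k => f k = y).card :=
    AddMonoidHom.card_fiber_eq_of_mem_range f (hf z) (hf y)
  have hsum := card_eq_sum_card_fiberwise (f := f) (s := univ) (t := univ) (by simp)
  rw [sum_congr rfl fun z _ => hfib z, sum_const, smul_eq_mul, card_univ, card_univ,
    Fintype.card_fun] at hsum
  rw [hsum, mul_comm]
  rfl

/-- Pearson χ² divergence bound for collinear LWE inputs: for `q` prime,
`x ≠ 0`, `x' = λx` with `λ ∉ {0,1}`, and `k` uniform on `(ℤ/qℤ)^n`,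
`√(Σ_{y,y'} (P[⟨k,x⟩=y ∧ ⟨k,x'⟩=y'] − q⁻²)² q²) ≤ √(q+1)`. -/
theorem lwe_pearson_bound
    (q : ℕ) [Fact (Nat.Prime q)] (n : ℕ) (hn : 1 ≤ n)
    (x : Fin n → ZMod q) (hx : x ≠ 0) (lam : ZMod q)
    (hlam0 : lam ≠ 0) (hlam1 : lam ≠ 1)
    (x' : Fin n → ZMod q) (hx' : x' = lam • x) :
    Real.sqrt (∑ y : ZMod q, ∑ y' : ZMod q,
        (((Finset.univ.filter
            (fun k : Fin n → ZMod q =>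
              (∑ j, k j * x j) = y ∧ (∑ j, k j * x' j) = y')).card : ℝ) / (q : ℝ) ^ n
          - ((q : ℝ) ^ 2)⁻¹) ^ 2 * (q : ℝ) ^ 2)
      ≤ Real.sqrt ((q : ℝ) + 1) := by
  have hq : (q : ℝ) ≠ 0 := Nat.cast_ne_zero.mpr (Fact.out : q.Prime).ne_zero
  have hmul (k : Fin n → ZMod q) : ∑ j, k j * x' j = lam * ∑ j, k j * x j := by
    simp [hx', mul_sum, mul_left_comm]
  have hprob (y y' : ZMod q) :
      ((univ.filter fun k : Fin n → ZMod q =>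
        (∑ j, k j * x j) = y ∧ (∑ j, k j * x' j) = y').card : ℝ) / (q : ℝ) ^ n
        = if lam * y = y' then (q : ℝ)⁻¹ else 0 := by
    split_ifs with h
    · have hset : (univ.filter fun k : Fin n → ZMod q =>
          (∑ j, k j * x j) = y ∧ (∑ j, k j * x' j) = y')
          = univ.filter fun k => ∑ j, k j * x j = y := by
        ext k
        simp only [mem_filter, mem_univ, true_and, hmul, and_iff_left_iff_imp]
        rintro rfl
        exact h
      have hcard := card_fiber_sum_mul hx y
      rw [ZMod.card, Fintype.card_fin] at hcard
      rw [hset, div_eq_iff (pow_ne_zero n hq), inv_mul_eq_div, eq_div_iff hq]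
      exact_mod_cast hcard
    · rw [filter_false_of_mem]
      · simp
      · rintro k - ⟨rfl, hk⟩
        exact h (hmul k ▸ hk)
  have hterm (y y' : ZMod q) :
      ((if lam * y = y' then (q : ℝ)⁻¹ else 0) - ((q : ℝ) ^ 2)⁻¹) ^ 2 * (q : ℝ) ^ 2
        = (if lam * y = y' then 1 - 2 * (q : ℝ)⁻¹ else 0) + ((q : ℝ) ^ 2)⁻¹ := by
    split_ifs
    · field_simp
      ring
    · field_simp
      ring
  have htotal : (q : ℝ) * (1 - 2 * (q : ℝ)⁻¹ + q * ((q : ℝ) ^ 2)⁻¹) = q - 1 := by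
    field_simp
    ring
  apply Real.sqrt_le_sqrt
  simp only [hprob, hterm, sum_add_distrib, sum_ite_eq, mem_univ, if_true, sum_const, card_univ,
    ZMod.card, nsmul_eq_mul]
  linarith
end

section
/- There exists a universal constant C > 0 with the following property. Let Σ be a 2×2 symmetric positive-definite real matrix and let (X, Y) be a centered bivariate Gaussian vector with covariance Σ. Then the total variation distance between the law of ({X}, {Y}) — where {t} denotes the fractional part of t — and the uniform distribution on [0,1]² is at most C · (Σ₁₁^{1/2} Σ₂₂^{1/2} + |Σ₁₂|) · (Σ₁₁^{1/2} + Σ₂₂^{1/2}) / (Σ₁₁ Σ₂₂ − Σ₁₂²). -/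
open MeasureTheory Real

/-- Total variation distance between two measures: `sup_S |ρ(S) − ν(S)|` over
measurable sets `S`. -/
noncomputable def tvDist {α : Type*} [MeasurableSpace α] (ρ ν : Measure α) : ℝ :=
  ⨆ s : {s : Set α // MeasurableSet s}, |(ρ s.val).toReal - (ν s.val).toReal|

/-- The centered bivariate Gaussian measure on `ℝ²` with (positive-definite)
covariance matrix `Σ`, defined by its density. -/
noncomputable def bivariateGaussian (S : Matrix (Fin 2) (Fin 2) ℝ) : Measure (ℝ × ℝ) :=
  volume.withDensity (fun z : ℝ × ℝ =>
    ENNReal.ofReal ((2 * Real.pi * Real.sqrt S.det)⁻¹ *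
      Real.exp (-(1/2) * ∑ i, ∑ j, (![z.1, z.2] i) * (S⁻¹ i j) * (![z.1, z.2] j))))

open Set ProbabilityTheory
open scoped ENNReal NNReal

/-- The quadratic form `p x² - 2 r x y + s y²` on the plane. -/
def binaryForm (p r s : ℝ) (z : ℝ × ℝ) : ℝ :=
  p * z.1 ^ 2 - 2 * r * z.1 * z.2 + s * z.2 ^ 2

/-- The function `z ↦ k exp (-Q(z) / 2)` for the quadratic form `Q = binaryForm p r s`. -/
noncomputable def expForm (k p r s : ℝ) (z : ℝ × ℝ) : ℝ :=
  k * Real.exp (-(1 / 2) * binaryForm p r s z)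

lemma expForm_pos {k p r s : ℝ} (hk : 0 < k) (z : ℝ × ℝ) : 0 < expForm k p r s z :=
  mul_pos hk (Real.exp_pos _)

lemma continuous_expForm (k p r s : ℝ) : Continuous (expForm k p r s) := by
  unfold expForm binaryForm
  fun_prop

lemma expForm_sub_sq (k p r s : ℝ) (z w : ℝ × ℝ) :
    expForm k p r s (z - w) ^ 2 =
      expForm k p r s z * (Real.exp (binaryForm p r s w) * expForm k p r s (z - (2 : ℝ) • w)) := by
  have h : Real.exp (-(1 / 2) * binaryForm p r s (z - w)) ^ 2 =
      Real.exp (-(1 / 2) * binaryForm p r s z) * (Real.exp (binaryForm p r s w) *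
        Real.exp (-(1 / 2) * binaryForm p r s (z - (2 : ℝ) • w))) := by
    rw [← Real.exp_add, ← Real.exp_add, ← Real.exp_nat_mul]
    congr 1
    simp only [binaryForm, Prod.fst_sub, Prod.snd_sub, Prod.smul_fst, Prod.smul_snd, smul_eq_mul]
    push_cast
    ring
  unfold expForm
  rw [mul_pow, h]
  ring

lemma abs_sub_le_of_sq_eq_mul {x y t ε : ℝ} (hx : 0 < x) (hε : 0 < ε) (h : y ^ 2 = x * t) :
    |x - y| ≤ (ε * x + (x - 2 * y + t) / ε) / 2 := by
  have key : 2 * ε * |x - y| ≤ ε ^ 2 * x + (x - 2 * y + t) := by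
    refine le_of_mul_le_mul_left ?_ hx
    nlinarith [sq_nonneg (ε * x - |x - y|), sq_abs (x - y)]
  have key_half : ε * |x - y| ≤ ε * ((ε * x + (x - 2 * y + t) / ε) / 2) := by
    have : ε * ((ε * x + (x - 2 * y + t) / ε) / 2) = (ε ^ 2 * x + (x - 2 * y + t)) / 2 := by
      field_simp
    linarith
  exact le_of_mul_le_mul_left key_half hε

/-- Translating a normalized Gaussian density by `w` moves it in `L¹` by at most a constant times
the Mahalanobis length of `w`. -/
lemma integral_abs_expForm_sub_le {k p r s : ℝ} (hk : 0 < k)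
    (hint : Integrable (expForm k p r s)) (hone : ∫ z, expForm k p r s z = 1)
    {w : ℝ × ℝ} {ε : ℝ} (hε : 0 < ε) (hε1 : ε ≤ 1) (hw0 : 0 ≤ binaryForm p r s w)
    (hw : binaryForm p r s w ≤ ε ^ 2) :
    ∫ z, |expForm k p r s z - expForm k p r s (z - w)| ≤ 2 * ε := by
  set f := expForm k p r s with hf
  set e := Real.exp (binaryForm p r s w) with he
  have i1 : Integrable (fun z => f (z - w)) := hint.comp_sub_right w
  have i2 : Integrable (fun z => f (z - (2 : ℝ) • w)) := hint.comp_sub_right _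
  have i0 : Integrable fun z => f z - 2 * f (z - w) := hint.sub (i1.const_mul 2)
  have i3 : Integrable fun z => f z - 2 * f (z - w) + e * f (z - (2 : ℝ) • w) :=
    i0.add (i2.const_mul e)
  have hval : ∫ z, (ε * f z + (f z - 2 * f (z - w) + e * f (z - (2 : ℝ) • w)) / ε) / 2
      = (ε + (e - 1) / ε) / 2 := by
    rw [integral_div, integral_add (hint.const_mul ε) (i3.div_const ε), integral_div,
      integral_add i0 (i2.const_mul e),
      integral_sub hint (i1.const_mul 2), integral_const_mul, integral_const_mul,
      integral_const_mul, integral_sub_right_eq_self f w,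
      integral_sub_right_eq_self f ((2 : ℝ) • w), hone]
    ring
  have hle : ∫ z, |f z - f (z - w)| ≤ (ε + (e - 1) / ε) / 2 := by
    rw [← hval]
    refine integral_mono (hint.sub i1).abs
      (((hint.const_mul ε).add (i3.div_const ε)).div_const 2) fun z => ?_
    exact abs_sub_le_of_sq_eq_mul (expForm_pos hk z) hε (expForm_sub_sq k p r s z w)
  have hq1 : binaryForm p r s w ≤ 1 := hw.trans (by nlinarith)
  have hexp : e - 1 ≤ 2 * binaryForm p r s w := by
    have := Real.abs_exp_sub_one_le (x := binaryForm p r s w) (by rwa [abs_of_nonneg hw0])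
    rw [abs_of_nonneg hw0] at this
    exact (le_abs_self _).trans this
  have : (e - 1) / ε ≤ 2 * ε := by
    rw [div_le_iff₀ hε]
    nlinarith
  linarith

lemma volume_restrict_map_fract_add (x : ℝ) :
    (volume.restrict (Icc (0 : ℝ) 1)).map (fun w => Int.fract (x + w)) =
      volume.restrict (Icc (0 : ℝ) 1) := by
  have hm : Measurable fun w : ℝ => Int.fract (x + w) := by fun_prop
  ext s hs
  have hE : MeasurableSet (Int.fract ⁻¹' s : Set ℝ) := measurable_fract hs
  rw [Measure.map_apply hm hs]
  have hL : volume.restrict (Icc (0 : ℝ) 1) ((fun w => Int.fract (x + w)) ⁻¹' s) =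
      volume ((Int.fract ⁻¹' s : Set ℝ) ∩ Ioc x (x + 1)) := by
    rw [← restrict_Ioc_eq_restrict_Icc, Measure.restrict_apply (hm hs),
      ← measure_preimage_add volume x ((Int.fract ⁻¹' s : Set ℝ) ∩ Ioc x (x + 1))]
    congr 1
    ext w
    simp
  have hR : volume.restrict (Icc (0 : ℝ) 1) s =
      volume ((Int.fract ⁻¹' s : Set ℝ) ∩ Ioc 0 (0 + 1)) := by
    rw [zero_add, ← Measure.restrict_apply hE, restrict_Ioc_eq_restrict_Icc,
      ← restrict_Ico_eq_restrict_Icc, Measure.restrict_apply hs, Measure.restrict_apply hE]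
    congr 1
    ext w
    simp only [mem_inter_iff, mem_preimage, and_congr_left_iff]
    intro hw
    rw [Int.fract_eq_self.2 ⟨hw.1, hw.2⟩]
  rw [hL, hR]
  refine (isAddFundamentalDomain_Ioc one_pos x).measure_set_eq
    (isAddFundamentalDomain_Ioc one_pos 0) hE fun g => ?_
  obtain ⟨_, n, rfl⟩ := g
  ext t
  simp [AddSubgroup.vadd_def]

/-- The coordinatewise fractional part `ℝ² → [0,1)²`. -/
noncomputable def fractPair (z : ℝ × ℝ) : ℝ × ℝ := (Int.fract z.1, Int.fract z.2)

lemma measurable_fractPair : Measurable fractPair := by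
  unfold fractPair
  fun_prop

/-- Lebesgue measure on the unit square. -/
noncomputable def squareMeasure : Measure (ℝ × ℝ) :=
  volume.restrict (Icc (0 : ℝ) 1 ×ˢ Icc (0 : ℝ) 1)

lemma squareMeasure_eq_prod : squareMeasure =
    (volume.restrict (Icc (0 : ℝ) 1)).prod (volume.restrict (Icc (0 : ℝ) 1)) := by
  rw [squareMeasure, Measure.prod_restrict, ← Measure.volume_eq_prod]

instance : IsProbabilityMeasure squareMeasure := by
  refine ⟨?_⟩
  rw [squareMeasure, Measure.restrict_apply_univ, Measure.volume_eq_prod, Measure.prod_prod]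
  simp

lemma squareMeasure_map_fractPair_add (z : ℝ × ℝ) :
    squareMeasure.map (fun w => fractPair (z + w)) = squareMeasure := by
  have h := Measure.map_prod_map (volume.restrict (Icc (0 : ℝ) 1)) (volume.restrict (Icc (0 : ℝ) 1))
    (f := fun w => Int.fract (z.1 + w)) (g := fun w => Int.fract (z.2 + w))
    (by fun_prop) (by fun_prop)
  rw [volume_restrict_map_fract_add, volume_restrict_map_fract_add] at h
  rw [squareMeasure_eq_prod]
  exact h.symm

/-- Adding an independent uniform vector of the unit square makes the fractional parts uniform. -/
lemma squareMeasure_real_eq_integral (P : Measure (ℝ × ℝ)) [IsProbabilityMeasure P]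
    {A : Set (ℝ × ℝ)} (hA : MeasurableSet A) :
    squareMeasure.real A =
      ∫ w, P.real ((fun z => z + w) ⁻¹' (fractPair ⁻¹' A)) ∂squareMeasure := by
  have hm : Measurable fun y : (ℝ × ℝ) × (ℝ × ℝ) => fractPair (y.1 + y.2) :=
    measurable_fractPair.comp (by fun_prop)
  have h1 := Measure.prod_apply (μ := P) (ν := squareMeasure) (hm hA)
  have h2 := Measure.prod_apply_symm (μ := P) (ν := squareMeasure) (hm hA)
  have h3 : ∫⁻ z, squareMeasure (Prod.mk z ⁻¹' ((fun y : (ℝ × ℝ) × (ℝ × ℝ) =>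
      fractPair (y.1 + y.2)) ⁻¹' A)) ∂P = squareMeasure A := by
    rw [← mul_one (squareMeasure A), ← measure_univ (μ := P), ← lintegral_const]
    refine lintegral_congr fun z => ?_
    conv_rhs => rw [← squareMeasure_map_fractPair_add z]
    have hz : Measurable fun w => fractPair (z + w) :=
      measurable_fractPair.comp (measurable_const_add z)
    rw [Measure.map_apply hz hA]
    rfl
  have hmeas : Measurable fun w => P ((fun z => z + w) ⁻¹' (fractPair ⁻¹' A)) :=
    measurable_measure_prodMk_right (hm hA)
  unfold Measure.real
  rw [integral_toReal hmeas.aemeasurable (Filter.Eventually.of_forall fun w => measure_lt_top _ _),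
    ← h3, ← h1, h2]
  rfl

/-- If a probability measure moves by at most `K` in total variation under translations by vectors
of the unit square, then the fractional parts are within `K` of uniform. -/
lemma tvDist_map_fractPair_le (P : Measure (ℝ × ℝ)) [IsProbabilityMeasure P] {K : ℝ}
    (hK : ∀ w ∈ Icc (0 : ℝ) 1 ×ˢ Icc (0 : ℝ) 1, ∀ E : Set (ℝ × ℝ), MeasurableSet E →
      |P.real E - P.real ((fun z => z + w) ⁻¹' E)| ≤ K) :
    tvDist (P.map fractPair) squareMeasure ≤ K := by
  have : Nonempty {s : Set (ℝ × ℝ) // MeasurableSet s} := ⟨⟨∅, MeasurableSet.empty⟩⟩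
  refine ciSup_le fun ⟨A, hA⟩ => ?_
  have hE := measurable_fractPair hA
  rw [Measure.map_apply measurable_fractPair hA]
  change |P.real _ - squareMeasure.real A| ≤ K
  have hmeas : Measurable fun w => P.real ((fun z => z + w) ⁻¹' (fractPair ⁻¹' A)) :=
    (measurable_measure_prodMk_right (μ := P) (s := (fun y : (ℝ × ℝ) × (ℝ × ℝ) =>
      fractPair (y.1 + y.2)) ⁻¹' A)
      ((measurable_fractPair.comp (by fun_prop)) hA)).ennreal_toReal
  have hint : Integrable (fun w => P.real ((fun z => z + w) ⁻¹' (fractPair ⁻¹' A)))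
      squareMeasure :=
    Integrable.of_bound hmeas.aestronglyMeasurable 1 (Filter.Eventually.of_forall fun w => by
      rw [Real.norm_of_nonneg measureReal_nonneg]
      exact measureReal_le_one)
  have hconst : P.real (fractPair ⁻¹' A) = ∫ _, P.real (fractPair ⁻¹' A) ∂squareMeasure := by simp
  rw [squareMeasure_real_eq_integral P hA, hconst, ← integral_sub (integrable_const _) hint]
  have hae : ∀ᵐ w ∂squareMeasure, ‖P.real (fractPair ⁻¹' A) -
      P.real ((fun z => z + w) ⁻¹' (fractPair ⁻¹' A))‖ ≤ K :=
    (ae_restrict_iff' (measurableSet_Icc.prod measurableSet_Icc)).2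
      (Filter.Eventually.of_forall fun w hw => hK w hw _ hE)
  simpa using norm_integral_le_of_norm_le_const hae

lemma withDensity_real_apply {f : ℝ × ℝ → ℝ} (hf : Integrable f) (hf0 : ∀ z, 0 ≤ f z)
    {E : Set (ℝ × ℝ)} (hE : MeasurableSet E) :
    (volume.withDensity fun z => ENNReal.ofReal (f z)).real E = ∫ z in E, f z := by
  rw [Measure.real, withDensity_apply _ hE, integral_eq_lintegral_of_nonneg_ae
    (Filter.Eventually.of_forall hf0) hf.aestronglyMeasurable.restrict]

lemma abs_withDensity_real_sub_preimage_add_le {f : ℝ × ℝ → ℝ} (hf : Integrable f)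
    (hf0 : ∀ z, 0 ≤ f z) (w : ℝ × ℝ) {E : Set (ℝ × ℝ)} (hE : MeasurableSet E) :
    |(volume.withDensity fun z => ENNReal.ofReal (f z)).real E -
      (volume.withDensity fun z => ENNReal.ofReal (f z)).real ((fun z => z + w) ⁻¹' E)| ≤
      ∫ z, |f z - f (z - w)| := by
  have hE' : MeasurableSet ((fun z => z + w) ⁻¹' E) := (measurable_add_const w) hE
  have i1 : Integrable (fun z => f (z - w)) := hf.comp_sub_right w
  have hshift : ∫ z in (fun z => z + w) ⁻¹' E, f z = ∫ z in E, f (z - w) := by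
    rw [← integral_indicator hE, ← integral_indicator hE',
      ← integral_add_right_eq_self (E.indicator fun z => f (z - w)) w]
    refine integral_congr_ae (Filter.Eventually.of_forall fun z => ?_)
    by_cases hz : z + w ∈ E <;> simp [indicator, hz]
  rw [withDensity_real_apply hf hf0 hE, withDensity_real_apply hf hf0 hE', hshift,
    ← integral_sub hf.integrableOn i1.integrableOn]
  refine (abs_integral_le_integral_abs).trans ?_
  exact setIntegral_le_integral (hf.sub i1).abs (Filter.Eventually.of_forall fun z => abs_nonneg _)

/-- The centered bivariate Gaussian density disintegrates as the product of the conditional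
density of the first coordinate and the marginal density of the second. -/
lemma expForm_eq_gaussianPDFReal_mul {a b c : ℝ} (hb : 0 < b) (hD : 0 < a * b - c ^ 2)
    (x y : ℝ) :
    expForm (2 * π * √(a * b - c ^ 2))⁻¹ (b / (a * b - c ^ 2)) (c / (a * b - c ^ 2))
        (a / (a * b - c ^ 2)) (x, y) =
      gaussianPDFReal (c * y / b) ((a * b - c ^ 2) / b).toNNReal x *
        gaussianPDFReal 0 b.toNNReal y := by
  set D := a * b - c ^ 2 with hDdef
  have ha : a = (D + c ^ 2) / b := by
    rw [hDdef]
    field_simp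
    ring
  have hexp : -(1 / 2) * binaryForm (b / D) (c / D) (a / D) (x, y) =
      -(x - c * y / b) ^ 2 / (2 * (D / b)) + -(y - 0) ^ 2 / (2 * b) := by
    rw [binaryForm, ha]
    field_simp
    ring
  have hsqrt : √(2 * π * (D / b)) * √(2 * π * b) = 2 * π * √D := by
    rw [← Real.sqrt_mul (by positivity)]
    have : 2 * π * (D / b) * (2 * π * b) = (2 * π) ^ 2 * D := by
      field_simp
    rw [this, Real.sqrt_mul (by positivity), Real.sqrt_sq (by positivity)]
  rw [expForm, hexp, Real.exp_add, gaussianPDFReal, gaussianPDFReal,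
    Real.coe_toNNReal _ (by positivity), Real.coe_toNNReal _ hb.le, ← hsqrt, mul_inv]
  ring

lemma lintegral_expForm_eq_one {a b c : ℝ} (hb : 0 < b) (hD : 0 < a * b - c ^ 2) :
    ∫⁻ z, ENNReal.ofReal (expForm (2 * π * √(a * b - c ^ 2))⁻¹ (b / (a * b - c ^ 2))
      (c / (a * b - c ^ 2)) (a / (a * b - c ^ 2)) z) = 1 := by
  rw [Measure.volume_eq_prod, lintegral_prod_symm _
    (continuous_expForm _ _ _ _).measurable.ennreal_ofReal.aemeasurable]
  have hv : ((a * b - c ^ 2) / b).toNNReal ≠ 0 := by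
    have : 0 < (a * b - c ^ 2) / b := by positivity
    simpa using this
  have hv' : b.toNNReal ≠ 0 := by simpa using hb
  calc _ = ∫⁻ y, gaussianPDF 0 b.toNNReal y := by
        refine lintegral_congr fun y => ?_
        simp_rw [expForm_eq_gaussianPDFReal_mul hb hD,
          ENNReal.ofReal_mul (gaussianPDFReal_nonneg _ _ _)]
        rw [lintegral_mul_const _ (measurable_gaussianPDFReal _ _).ennreal_ofReal,
          lintegral_gaussianPDFReal_eq_one _ hv, one_mul]
        rfl
    _ = 1 := lintegral_gaussianPDF_eq_one 0 hv'

lemma bivariateGaussian_eq_withDensity_expForm {S : Matrix (Fin 2) (Fin 2) ℝ}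
    (hsymm : S 1 0 = S 0 1) (hD : S 0 0 * S 1 1 - S 0 1 ^ 2 ≠ 0) :
    bivariateGaussian S = volume.withDensity fun z => ENNReal.ofReal
      (expForm (2 * π * √(S 0 0 * S 1 1 - S 0 1 ^ 2))⁻¹ (S 1 1 / (S 0 0 * S 1 1 - S 0 1 ^ 2))
        (S 0 1 / (S 0 0 * S 1 1 - S 0 1 ^ 2)) (S 0 0 / (S 0 0 * S 1 1 - S 0 1 ^ 2)) z) := by
  have hdet : S.det = S 0 0 * S 1 1 - S 0 1 ^ 2 := by
    rw [Matrix.det_fin_two, hsymm]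
    ring
  unfold bivariateGaussian expForm
  rw [hdet]
  congr 1
  ext z
  congr 4
  rw [Matrix.inv_def, Matrix.adjugate_fin_two, hdet, Ring.inverse_eq_inv', hsymm]
  simp [Fin.sum_univ_two, binaryForm]
  field_simp
  ring

/-- On the unit square the Mahalanobis form is at most `(√a + √b)² / D`. -/
lemma binaryForm_le_of_mem_square {a b c D : ℝ} (ha : 0 < a) (hb : 0 < b) (hD : 0 < D)
    (hdet : a * b - c ^ 2 = D) {w : ℝ × ℝ} (hw : w ∈ Icc (0 : ℝ) 1 ×ˢ Icc (0 : ℝ) 1) :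
    0 ≤ binaryForm (b / D) (c / D) (a / D) w ∧
      binaryForm (b / D) (c / D) (a / D) w ≤ ((√a + √b) / √D) ^ 2 := by
  obtain ⟨⟨hu0, hu1⟩, hv0, hv1⟩ := hw
  have hq : binaryForm (b / D) (c / D) (a / D) w =
      (b * w.1 ^ 2 - 2 * c * w.1 * w.2 + a * w.2 ^ 2) / D := by
    rw [binaryForm]
    ring
  have hsa := Real.sq_sqrt ha.le
  have hsb := Real.sq_sqrt hb.le
  have hc : |c| ≤ √a * √b := by
    rw [← Real.sqrt_mul ha.le]
    exact Real.abs_le_sqrt (by linarith)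
  have hcw : |c * (w.1 * w.2)| ≤ √a * √b * (w.1 * w.2) := by
    rw [abs_mul, abs_of_nonneg (mul_nonneg hu0 hv0)]
    exact mul_le_mul_of_nonneg_right hc (mul_nonneg hu0 hv0)
  obtain ⟨hcw1, hcw2⟩ := abs_le.1 hcw
  rw [hq, div_pow, Real.sq_sqrt hD.le]
  constructor
  · refine div_nonneg ?_ hD.le
    nlinarith [sq_nonneg (√b * w.1 - √a * w.2)]
  · refine div_le_div_of_nonneg_right ?_ hD.le
    have h1 : √b * w.1 + √a * w.2 ≤ √a + √b := by
      nlinarith [Real.sqrt_nonneg a, Real.sqrt_nonneg b]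
    have h2 : 0 ≤ √b * w.1 + √a * w.2 := by positivity
    nlinarith [pow_le_pow_left₀ h2 h1 2]

/-- there is a universal constant `C > 0` such that for every `2×2` symmetric
positive-definite `Σ` and `(X,Y)` a centered Gaussian with covariance `Σ`, the total
variation distance between the law of `({X},{Y})` and the uniform distribution on `[0,1]²`
is at most `C (Σ₁₁^{1/2}Σ₂₂^{1/2} + |Σ₁₂|)(Σ₁₁^{1/2} + Σ₂₂^{1/2}) / (Σ₁₁Σ₂₂ − Σ₁₂²)`. -/
theorem fract_gaussian_tv_bound :
    ∃ C : ℝ, 0 < C ∧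
      ∀ (S : Matrix (Fin 2) (Fin 2) ℝ), S.PosDef →
        tvDist
            ((bivariateGaussian S).map (fun z : ℝ × ℝ => (Int.fract z.1, Int.fract z.2)))
            (volume.restrict (Set.Icc (0:ℝ) 1 ×ˢ Set.Icc (0:ℝ) 1))
          ≤ C * (Real.sqrt (S 0 0) * Real.sqrt (S 1 1) + |S 0 1|) *
              (Real.sqrt (S 0 0) + Real.sqrt (S 1 1)) /
              (S 0 0 * S 1 1 - (S 0 1) ^ 2) := by
  refine ⟨2, two_pos, fun S hS => ?_⟩
  have hsymm : S 1 0 = S 0 1 := by simpa using hS.isHermitian.apply 0 1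
  have ha : 0 < S 0 0 := hS.diag_pos
  have hb : 0 < S 1 1 := hS.diag_pos
  have hD : 0 < S 0 0 * S 1 1 - S 0 1 ^ 2 := by
    have := hS.det_pos
    rw [Matrix.det_fin_two, hsymm] at this
    linarith
  rw [bivariateGaussian_eq_withDensity_expForm hsymm hD.ne']
  generalize S 0 0 = a at *
  generalize S 1 1 = b at *
  generalize S 0 1 = c at *
  have hlint := lintegral_expForm_eq_one hb hD
  obtain ⟨D, hdet⟩ : ∃ D, a * b - c ^ 2 = D := ⟨_, rfl⟩
  rw [hdet] at hD hlint ⊢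
  have hk : 0 < (2 * π * √D)⁻¹ := by positivity
  set f := expForm (2 * π * √D)⁻¹ (b / D) (c / D) (a / D) with hf
  have hf0 : ∀ z, 0 ≤ f z := fun z => (expForm_pos hk z).le
  have hfm : AEStronglyMeasurable f := (continuous_expForm _ _ _ _).aestronglyMeasurable
  have hint : Integrable f := by
    refine (lintegral_ofReal_ne_top_iff_integrable hfm (Filter.Eventually.of_forall hf0)).1 ?_
    rw [hlint]
    exact ENNReal.one_ne_top
  have hone : ∫ z, f z = 1 := by
    rw [integral_eq_lintegral_of_nonneg_ae (Filter.Eventually.of_forall hf0) hfm, hlint,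
      ENNReal.toReal_one]
  have : IsProbabilityMeasure (volume.withDensity fun z => ENNReal.ofReal (f z)) :=
    ⟨by rw [withDensity_apply _ MeasurableSet.univ, Measure.restrict_univ, hlint]⟩
  have hK0 : 0 < (√a + √b) / √D := by positivity
  have hbound : tvDist ((volume.withDensity fun z => ENNReal.ofReal (f z)).map fractPair)
      squareMeasure ≤ 2 * ((√a + √b) / √D) := by
    refine tvDist_map_fractPair_le _ fun w hw E hE => ?_
    rcases le_total ((√a + √b) / √D) 1 with h1 | h1
    · obtain ⟨hw0, hw1⟩ := binaryForm_le_of_mem_square ha hb hD hdet hw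
      exact (abs_withDensity_real_sub_preimage_add_le hint hf0 w hE).trans
        (integral_abs_expForm_sub_le hk hint hone hK0 h1 hw0 hw1)
    · exact (abs_sub_le_of_nonneg_of_le measureReal_nonneg measureReal_le_one measureReal_nonneg
        measureReal_le_one).trans (by linarith)
  refine hbound.trans ?_
  have hDab : √D ≤ √a * √b + |c| := by
    rw [← Real.sqrt_mul ha.le]
    exact (Real.sqrt_le_sqrt (by nlinarith [sq_nonneg c])).trans
      (le_add_of_nonneg_right (abs_nonneg c))
  calc 2 * ((√a + √b) / √D) = 2 * √D * (√a + √b) / D := by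
        nth_rewrite 3 [← Real.mul_self_sqrt hD.le]
        field_simp
    _ ≤ 2 * (√a * √b + |c|) * (√a + √b) / D := by gcongr
end

section
/- There exists a universal constant C > 0 such that for all real numbers a, b with (a,b) ≠ (0,0) and every R > 0: ∫_{[0,1]²} e^{−2π²R²(ax+by)²} dx dy ≤ C / ( R √(a² + b²) ). -/
open MeasureTheory Real

theorem setIntegral_gaussian_comp_affine_le (s : Set ℝ) {k a : ℝ} (hk : 0 < k) (ha : a ≠ 0)
    (c : ℝ) :
    ∫ x in s, Real.exp (-(k * (a * x + c) ^ 2)) ≤ √(π / k) / |a| := by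
  have hshift : Integrable fun y : ℝ => Real.exp (-k * (y + c) ^ 2) :=
    (integrable_exp_neg_mul_sq hk).comp_add_right c
  have hint : Integrable fun x : ℝ => Real.exp (-k * (a * x + c) ^ 2) :=
    hshift.comp_mul_left' ha
  have hval : ∫ x : ℝ, Real.exp (-k * (a * x + c) ^ 2) = √(π / k) / |a| := by
    rw [Measure.integral_comp_mul_left (fun y : ℝ => Real.exp (-k * (y + c) ^ 2)) a,
      integral_add_right_eq_self (fun y : ℝ => Real.exp (-k * y ^ 2)) c, integral_gaussian,
      smul_eq_mul, abs_inv, div_eq_inv_mul _ |a|]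
  simp only [← neg_mul]
  rw [← hval]
  exact setIntegral_le_integral hint (.of_forall fun x => (Real.exp_pos _).le)

theorem square_gaussian_integral_le_of_abs_le {a b R : ℝ} (ha : a ≠ 0) (hba : |b| ≤ |a|)
    (hR : 0 < R) :
    (∫ z in (Set.Icc (0 : ℝ) 1 ×ˢ Set.Icc (0 : ℝ) 1),
        Real.exp (-(2 * Real.pi ^ 2 * R ^ 2 * (a * z.2 + b * z.1) ^ 2)))
      ≤ 2 / (R * Real.sqrt (a ^ 2 + b ^ 2)) := by
  have hcont : Continuous fun z : ℝ × ℝ =>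
      Real.exp (-(2 * Real.pi ^ 2 * R ^ 2 * (a * z.2 + b * z.1) ^ 2)) := by fun_prop
  have hint := hcont.continuousOn.integrableOn_compact (μ := volume)
    ((isCompact_Icc (a := (0 : ℝ)) (b := 1)).prod (isCompact_Icc (a := (0 : ℝ)) (b := 1)))
  have ha' : 0 < |a| := abs_pos.mpr ha
  have hsqrt : √(π / (2 * π ^ 2 * R ^ 2)) ≤ 1 / R := by
    refine Real.sqrt_le_iff.mpr ⟨by positivity, ?_⟩
    rw [div_pow, one_pow, div_le_div_iff₀ (by positivity) (by positivity)]
    nlinarith [Real.pi_gt_three, mul_pos Real.pi_pos (pow_pos hR 2)]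
  have hinner (y : ℝ) : ∫ x in Set.Icc (0 : ℝ) 1,
      Real.exp (-(2 * π ^ 2 * R ^ 2 * (a * x + b * y) ^ 2)) ≤ 1 / R / |a| :=
    (setIntegral_gaussian_comp_affine_le _ (by positivity) ha _).trans (by gcongr)
  have hnorm : √(a ^ 2 + b ^ 2) ≤ 2 * |a| := by
    refine Real.sqrt_le_iff.mpr ⟨by positivity, ?_⟩
    nlinarith [sq_le_sq.mpr hba, sq_abs a, sq_nonneg a]
  have hpos : 0 < √(a ^ 2 + b ^ 2) := by positivity
  rw [Measure.volume_eq_prod] at hint ⊢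
  calc
    _ = ∫ y in Set.Icc (0 : ℝ) 1, ∫ x in Set.Icc (0 : ℝ) 1,
          Real.exp (-(2 * π ^ 2 * R ^ 2 * (a * x + b * y) ^ 2)) := setIntegral_prod _ hint
    _ ≤ ∫ _ in Set.Icc (0 : ℝ) 1, 1 / R / |a| := by
      refine integral_mono_of_nonneg (.of_forall fun y => ?_) (integrable_const _)
        (.of_forall hinner)
      exact integral_nonneg fun x => (Real.exp_pos _).le
    _ = 1 / R / |a| := by simp
    _ ≤ 2 / (R * √(a ^ 2 + b ^ 2)) := by
      rw [div_div, div_le_div_iff₀ (by positivity) (by positivity)]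
      nlinarith

/-- there is a universal constant `C > 0` such that for all `(a,b) ≠ (0,0)`
and `R > 0`, `∫_{[0,1]²} exp(−2π²R²(ax+by)²) dx dy ≤ C / (R √(a²+b²))`. -/
theorem square_gaussian_integral_bound :
    ∃ C : ℝ, 0 < C ∧ ∀ (a b R : ℝ), (a, b) ≠ ((0 : ℝ), (0 : ℝ)) → 0 < R →
      (∫ z in (Set.Icc (0:ℝ) 1 ×ˢ Set.Icc (0:ℝ) 1),
          Real.exp (-(2 * Real.pi ^ 2 * R ^ 2 * (a * z.1 + b * z.2) ^ 2)))
        ≤ C / (R * Real.sqrt (a ^ 2 + b ^ 2)) := by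
  refine ⟨2, two_pos, fun a b R hab hR => ?_⟩
  rcases le_total |a| |b| with h | h
  · have hb : b ≠ 0 := by
      rintro rfl
      exact hab (by simpa using h)
    simpa only [add_comm] using square_gaussian_integral_le_of_abs_le hb h hR
  · have ha : a ≠ 0 := by
      rintro rfl
      exact hab (by simpa using h)
    refine le_trans (le_of_eq ?_) (square_gaussian_integral_le_of_abs_le ha h hR)
    rw [Measure.volume_eq_prod]
    exact setIntegral_prod_swap (μ := volume) (ν := volume) (Set.Icc (0 : ℝ) 1)
      (Set.Icc (0 : ℝ) 1)
      fun z : ℝ × ℝ => Real.exp (-(2 * π ^ 2 * R ^ 2 * (a * z.2 + b * z.1) ^ 2))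
end

section
/- Koksma–Hlawka inequality for measures: let f : [0,1]² → ℝ satisfy ‖f(·,1)‖_{BV([0,1])} < ∞, ‖f(1,·)‖_{BV([0,1])} < ∞, ‖f(·,0)‖_{BV([0,1])} < ∞, ‖f(0,·)‖_{BV([0,1])} < ∞ and V²(f) < ∞, and let ν be a Borel probability measure on [0,1]² with marginals ν₁, ν₂. Then | ∫_{[0,1]²} f dν − ∫_{[0,1]²} f(x) dx | ≤ ‖f(·,1)‖_{BV([0,1])} · D*(ν₁) + ‖f(1,·)‖_{BV([0,1])} · D*(ν₂) + V²(f) · D*(ν). -/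
open MeasureTheory

/-- A partition `0 = t₀ ≤ ⋯ ≤ t_n = 1` of `[0,1]`. -/
structure Partition01 where
  n : ℕ
  t : Fin (n + 1) → ℝ
  mono : Monotone t
  first : t 0 = 0
  last : t (Fin.last n) = 1

/-- The sum `Σᵢ |g(tᵢ) − g(tᵢ₋₁)|` along a partition. -/
noncomputable def bvSum (g : ℝ → ℝ) (P : Partition01) : ℝ :=
  ∑ i : Fin P.n, |g (P.t i.succ) - g (P.t i.castSucc)|

/-- Total variation `‖g‖_{BV([0,1])}`: supremum of `bvSum` over all partitions. -/
noncomputable def bvNorm (g : ℝ → ℝ) : ℝ :=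
  ⨆ P : Partition01, bvSum g P

/-- Vitali double-difference sum for a pair of partitions. -/
noncomputable def vitaliSum (f : ℝ → ℝ → ℝ) (P Q : Partition01) : ℝ :=
  ∑ i : Fin P.n, ∑ j : Fin Q.n,
    |f (P.t i.succ) (Q.t j.succ) - f (P.t i.castSucc) (Q.t j.succ)
      - f (P.t i.succ) (Q.t j.castSucc) + f (P.t i.castSucc) (Q.t j.castSucc)|

/-- Vitali variation `V²(f)` on `[0,1]²`. -/
noncomputable def vitaliVar (f : ℝ → ℝ → ℝ) : ℝ :=
  ⨆ PQ : Partition01 × Partition01, vitaliSum f PQ.1 PQ.2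

/-- Star-discrepancy of a Borel probability measure on `[0,1]²` (as a measure on `ℝ²`). -/
noncomputable def starDisc2 (ρ : Measure (ℝ × ℝ)) : ℝ :=
  ⨆ u : Set.Icc (0:ℝ) 1 × Set.Icc (0:ℝ) 1,
    |(ρ (Set.Ico (0:ℝ) (u.1 : ℝ) ×ˢ Set.Ico (0:ℝ) (u.2 : ℝ))).toReal
      - (u.1 : ℝ) * (u.2 : ℝ)|

/-- Star-discrepancy of a Borel probability measure on `[0,1]` (as a measure on `ℝ`). -/
noncomputable def starDisc1 (ρ : Measure ℝ) : ℝ :=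
  ⨆ u : Set.Icc (0:ℝ) 1, |(ρ (Set.Ico (0:ℝ) (u : ℝ))).toReal - (u : ℝ)|

open Set Filter Topology ENNReal

namespace Partition01

lemma t_mem (P : Partition01) (k : Fin (P.n + 1)) : P.t k ∈ Icc (0 : ℝ) 1 :=
  ⟨P.first ▸ P.mono (Fin.zero_le k), P.last ▸ P.mono (Fin.le_last k)⟩

lemma exists_of_finset (T : Finset ℝ) (h0 : (0 : ℝ) ∈ T) (h1 : (1 : ℝ) ∈ T)
    (hT : ∀ x ∈ T, x ∈ Icc (0 : ℝ) 1) :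
    ∃ P : Partition01, ∃ e : T ≃o Fin (P.n + 1), ∀ x, P.t (e x) = x := by
  have hc : T.card = (T.card - 1) + 1 := by
    have := Finset.card_pos.2 ⟨_, h0⟩
    omega
  let e := T.orderIsoOfFin hc
  refine ⟨⟨T.card - 1, fun k => e k, fun a b hab => e.monotone hab, ?_, ?_⟩, e.symm, fun x => ?_⟩
  · refine le_antisymm ?_ (hT _ (e 0).2).1
    have h : e 0 ≤ e (e.symm ⟨0, h0⟩) := e.monotone (Fin.zero_le _)
    rw [e.apply_symm_apply] at h
    exact h
  · refine le_antisymm (hT _ (e _).2).2 ?_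
    have h : e (e.symm ⟨1, h1⟩) ≤ e (Fin.last _) := e.monotone (Fin.le_last _)
    rw [e.apply_symm_apply] at h
    exact h
  · change ((e (e.symm x) : T) : ℝ) = x
    rw [e.apply_symm_apply]

lemma exists_of_monotone (n : ℕ) (u : ℕ → ℝ) (hu : Monotone u) (hu' : ∀ i, u i ∈ Icc (0 : ℝ) 1) :
    ∃ P : Partition01, ∀ w : ℝ → ℝ → ℝ, (∀ a b, 0 ≤ w a b) →
      ∑ i ∈ Finset.range n, w (u i) (u (i + 1))
        ≤ ∑ k : Fin P.n, w (P.t k.castSucc) (P.t k.succ) := by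
  let v : ℕ → ℝ := fun k => if k = 0 then 0 else if k ≤ n + 1 then u (k - 1) else 1
  have hv : Monotone v := by
    refine monotone_nat_of_le_succ fun k => ?_
    have h2 := hu (show k - 1 ≤ k by omega)
    have h3 := hu' k
    have h4 := hu' (k - 1)
    simp only [v, Nat.add_sub_cancel]
    split_ifs <;> first | contradiction | omega | exact h3.1 | exact h2 | exact h4.2 | norm_num
  refine ⟨⟨n + 2, fun k => v k, fun a b hab => hv hab, by simp [v], by simp [v]⟩, fun w hw => ?_⟩
  change _ ≤ ∑ k : Fin (n + 2), w (v k) (v (k + 1))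
  rw [Fin.sum_univ_eq_sum_range (fun k => w (v k) (v (k + 1))), Finset.sum_range_succ,
    Finset.sum_range_succ']
  have : ∑ i ∈ Finset.range n, w (u i) (u (i + 1))
      = ∑ k ∈ Finset.range n, w (v (k + 1)) (v (k + 1 + 1)) := by
    refine Finset.sum_congr rfl fun i hi => ?_
    have := Finset.mem_range.1 hi
    simp only [v]
    rw [if_neg (by omega), if_pos (by omega), if_neg (by omega), if_pos (by omega)]
    simp
  rw [this]
  linarith [hw (v 0) (v 1), hw (v (n + 1)) (v (n + 1 + 1))]

end Partition01

lemma abel_fin {n : ℕ} (c : Fin (n + 1) → ℝ) (i : Fin (n + 1)) :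
    c i = c (Fin.last n)
      - ∑ k : Fin n, (c k.succ - c k.castSucc) * (if i < k.succ then 1 else 0) := by
  induction i using Fin.reverseInduction with
  | last =>
    rw [Finset.sum_eq_zero, sub_zero]
    intro k _
    rw [if_neg (not_lt.2 (Fin.le_last _)), mul_zero]
  | cast m ih =>
    have : ∀ k : Fin n, (c k.succ - c k.castSucc) * (if m.castSucc < k.succ then (1 : ℝ) else 0)
        = (c k.succ - c k.castSucc) * (if m.succ < k.succ then 1 else 0)
          + if k = m then (c k.succ - c k.castSucc) else 0 := by
      intro k
      simp only [Fin.lt_def, Fin.ext_iff, Fin.val_castSucc, Fin.val_succ]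
      split_ifs <;> first | omega | ring
    simp_rw [this]
    rw [Finset.sum_add_distrib, Finset.sum_ite_eq' Finset.univ m]
    simp only [Finset.mem_univ, if_true]
    linarith

lemma abel_fin₂ {m n : ℕ} (c : Fin (m + 1) → Fin (n + 1) → ℝ) (i : Fin (m + 1))
    (j : Fin (n + 1)) :
    c i j = c (Fin.last m) (Fin.last n)
      - ∑ k : Fin m, (c k.succ (Fin.last n) - c k.castSucc (Fin.last n))
          * (if i < k.succ then 1 else 0)
      - ∑ l : Fin n, (c (Fin.last m) l.succ - c (Fin.last m) l.castSucc)
          * (if j < l.succ then 1 else 0)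
      + ∑ k : Fin m, ∑ l : Fin n,
          (c k.succ l.succ - c k.castSucc l.succ - c k.succ l.castSucc + c k.castSucc l.castSucc)
          * ((if i < k.succ then 1 else 0) * (if j < l.succ then 1 else 0)) := by
  have h1 := abel_fin (c i) j
  have h2 : ∀ l : Fin n, c i l.succ - c i l.castSucc = _ :=
    fun l => abel_fin (fun i => c i l.succ - c i l.castSucc) i
  rw [h1, abel_fin (fun i => c i (Fin.last n)) i, Finset.sum_comm (s := Finset.univ (α := Fin m))]
  simp_rw [h2, sub_mul]
  rw [Finset.sum_sub_distrib, Finset.sum_sub_distrib]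
  simp_rw [Finset.sum_mul]
  have : ∀ (l : Fin n) (k : Fin m),
      (c k.succ l.succ - c k.castSucc l.succ - c k.succ l.castSucc + c k.castSucc l.castSucc)
          * ((if i < k.succ then 1 else 0) * (if j < l.succ then 1 else 0))
      = (c k.succ l.succ - c k.succ l.castSucc - (c k.castSucc l.succ - c k.castSucc l.castSucc))
          * (if i < k.succ then 1 else 0) * (if j < l.succ then 1 else 0) := by
    intros; ring
  simp_rw [this, sub_mul, Finset.sum_sub_distrib]
  ring

lemma abs_sub_zero_le_sum {n : ℕ} (c : Fin (n + 1) → ℝ) (i : Fin (n + 1)) :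
    |c i - c 0| ≤ ∑ k : Fin n, |c k.succ - c k.castSucc| := by
  have h : c i - c 0 = ∑ k : Fin n, ((c k.succ - c k.castSucc) * (if 0 < k.succ then 1 else 0)
      - (c k.succ - c k.castSucc) * (if i < k.succ then 1 else 0)) := by
    rw [Finset.sum_sub_distrib]
    linarith [abel_fin c i, abel_fin c 0]
  rw [h]
  refine (Finset.abs_sum_le_sum_abs _ _).trans (Finset.sum_le_sum fun k _ => ?_)
  rw [if_pos (Fin.succ_pos k)]
  split_ifs <;> simp

/-- The `x`-increments of `f`, uniformly in `y`, are controlled by those of one monotone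
function. -/
lemma exists_monotone_control (f : ℝ → ℝ → ℝ)
    (h3 : BddAbove (range (bvSum (fun x => f x 0))))
    (h5 : BddAbove (range (fun PQ : Partition01 × Partition01 => vitaliSum f PQ.1 PQ.2))) :
    ∃ F : ℝ → ℝ, MonotoneOn F (Icc 0 1) ∧
      ∀ x ∈ Icc (0 : ℝ) 1, ∀ x' ∈ Icc (0 : ℝ) 1, ∀ y ∈ Icc (0 : ℝ) 1,
        |f x y - f x' y| ≤ |F x - F x'| := by
  obtain ⟨B₁, hB₁⟩ := h3
  obtain ⟨B₂, hB₂⟩ := h5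
  let Φ : ℝ → UniformFun (Icc (0 : ℝ) 1) ℝ := fun x => UniformFun.ofFun fun y => f x y
  have hΦ : eVariationOn Φ (Icc 0 1) ≤ ENNReal.ofReal (B₁ + B₂) := by
    refine iSup_le ?_
    rintro ⟨n, u, hu, hu'⟩
    obtain ⟨P, hP⟩ := Partition01.exists_of_monotone n u hu hu'
    have : ∀ i, edist (Φ (u (i + 1))) (Φ (u i)) = ⨆ Y : Finset (Icc (0 : ℝ) 1),
        ⨆ y ∈ Y, edist (f (u (i + 1)) y) (f (u i) y) := fun i => by
      rw [UniformFun.edist_def, iSup_eq_iSup_finset]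
      rfl
    simp only [this]
    rw [ENNReal.finsetSum_iSup_of_monotone
      (fun i Y Y' h => biSup_mono fun y hy => Finset.mem_of_subset h hy)]
    refine iSup_le fun Y => ?_
    obtain ⟨Q, e, hQ⟩ := Partition01.exists_of_finset
      (insert 0 (insert 1 (Y.map (Function.Embedding.subtype _)))) (by simp) (by simp) (by
        intro x hx
        simp only [Finset.mem_insert, Finset.mem_map, Function.Embedding.subtype_apply] at hx
        rcases hx with rfl | rfl | ⟨y, -, rfl⟩
        · simp
        · simp
        · exact y.2)
    let w : ℝ → ℝ → ℝ := fun a b => |f b 0 - f a 0| + ∑ j : Fin Q.n,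
      |f b (Q.t j.succ) - f a (Q.t j.succ) - f b (Q.t j.castSucc) + f a (Q.t j.castSucc)|
    have hw : ∀ a b, 0 ≤ w a b := fun a b => by positivity
    have key : ∀ i, (⨆ y ∈ Y, edist (f (u (i + 1)) y) (f (u i) y))
        ≤ ENNReal.ofReal (w (u i) (u (i + 1))) := by
      refine fun i => iSup₂_le fun y hy => ?_
      rw [edist_dist, Real.dist_eq]
      refine ENNReal.ofReal_le_ofReal ?_
      have hy' : (y : ℝ) ∈ insert 0 (insert 1 (Y.map (Function.Embedding.subtype _))) := by
        simp [hy, y.2.1, y.2.2]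
      have h := abs_sub_zero_le_sum
        (fun k => f (u (i + 1)) (Q.t k) - f (u i) (Q.t k)) (e ⟨y, hy'⟩)
      simp only [hQ, Q.first] at h
      have h' : ∀ j : Fin Q.n, f (u (i + 1)) (Q.t j.succ) - f (u i) (Q.t j.succ)
          - (f (u (i + 1)) (Q.t j.castSucc) - f (u i) (Q.t j.castSucc))
          = f (u (i + 1)) (Q.t j.succ) - f (u i) (Q.t j.succ)
            - f (u (i + 1)) (Q.t j.castSucc) + f (u i) (Q.t j.castSucc) := fun j => by ring
      simp_rw [h'] at h
      have h'' := abs_sub_abs_le_abs_sub (f (u (i + 1)) y - f (u i) y)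
        (f (u (i + 1)) 0 - f (u i) 0)
      change _ ≤ |f (u (i + 1)) 0 - f (u i) 0| + _
      linarith
    refine (Finset.sum_le_sum fun i _ => key i).trans ?_
    rw [← ENNReal.ofReal_sum_of_nonneg fun i _ => hw _ _]
    refine ENNReal.ofReal_le_ofReal ((hP w hw).trans ?_)
    rw [Finset.sum_add_distrib]
    exact add_le_add (hB₁ ⟨P, rfl⟩) (hB₂ ⟨(P, Q), rfl⟩)
  have hfin : ∀ x ∈ Icc (0 : ℝ) 1, eVariationOn Φ (Icc 0 x) ≠ ∞ := fun x hx =>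
    ((eVariationOn.mono Φ (Icc_subset_Icc_right hx.2)).trans hΦ).trans_lt ofReal_lt_top |>.ne
  refine ⟨fun x => (eVariationOn Φ (Icc 0 x)).toReal, fun x hx x' hx' h =>
    ENNReal.toReal_mono (hfin x' hx') (eVariationOn.mono Φ (Icc_subset_Icc_right h)), ?_⟩
  intro x hx x' hx' y hy
  wlog h : x' ≤ x generalizing x x'
  · rw [abs_sub_comm, abs_sub_comm (ENNReal.toReal _)]
    exact this x' hx' x hx (le_of_not_ge h)
  refine le_trans ?_ (le_abs_self _)
  have hadd := eVariationOn.Icc_add_Icc Φ (s := univ) hx'.1 h (mem_univ _)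
  simp only [univ_inter] at hadd
  have hfin' : eVariationOn Φ (Icc x' x) ≠ ∞ := fun htop => hfin x hx (by rw [← hadd, htop, add_top])
  dsimp only
  rw [← hadd, ENNReal.toReal_add (hfin x' hx') hfin', add_sub_cancel_left]
  have h1 : edist (f x y) (f x' y) ≤ edist (Φ x) (Φ x') :=
    UniformFun.edist_eval_le (f := Φ x) (g := Φ x') (x := ⟨y, hy⟩)
  have h2 := h1.trans (eVariationOn.edist_le Φ (s := Icc x' x) ⟨h, le_rfl⟩ ⟨le_rfl, h⟩)
  rw [← Real.dist_eq, dist_edist]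
  exact ENNReal.toReal_mono hfin' h2

/-- A function that is monotone on `[0,1]` is nearly constant on the fibres of a monotone map onto
the nodes of a suitable partition. -/
lemma exists_partition_approx (F : ℝ → ℝ) (hF : MonotoneOn F (Icc 0 1)) {ε : ℝ} (hε : 0 < ε) :
    ∃ P : Partition01, ∃ i : ℝ → Fin (P.n + 1), Monotone i ∧ i 1 = Fin.last P.n ∧
      ∀ x ∈ Icc (0 : ℝ) 1, |F x - F (P.t (i x))| ≤ ε := by
  classical
  let g : ℝ → ℤ := fun x => ⌊F x / ε⌋
  have hg : MonotoneOn g (Icc 0 1) := fun x hx y hy h =>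
    Int.floor_mono (div_le_div_of_nonneg_right (hF hx hy h) hε.le)
  have m0 : (0 : ℝ) ∈ Icc (0 : ℝ) 1 := by simp
  have m1 : (1 : ℝ) ∈ Icc (0 : ℝ) 1 := by simp
  let r : ℤ → ℝ := fun k => if k = g 1 then 1 else
    if h : ∃ x ∈ Icc (0 : ℝ) 1, g x = k then h.choose else 0
  have hr : ∀ k, r k ∈ Icc (0 : ℝ) 1 := by
    intro k
    simp only [r]
    split_ifs with h1 h2
    · exact m1
    · exact h2.choose_spec.1
    · exact m0
  have hgr : ∀ x ∈ Icc (0 : ℝ) 1, g (r (g x)) = g x := by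
    intro x hx
    have h2 : ∃ x' ∈ Icc (0 : ℝ) 1, g x' = g x := ⟨x, hx, rfl⟩
    simp only [r]
    split_ifs with h1
    · exact h1.symm
    · exact h2.choose_spec.2
  obtain ⟨P, e, hP⟩ := Partition01.exists_of_finset
    (insert 0 (insert 1 ((Finset.Icc (g 0) (g 1)).image r))) (by simp) (by simp) (by
      intro x hx
      simp only [Finset.mem_insert, Finset.mem_image] at hx
      rcases hx with rfl | rfl | ⟨y, -, rfl⟩
      · exact m0
      · exact m1
      · exact hr y)
  let p : ℝ → ℝ := fun x => projIcc (0 : ℝ) 1 zero_le_one x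
  have hp : ∀ x, p x ∈ Icc (0 : ℝ) 1 := fun x => (projIcc (0 : ℝ) 1 zero_le_one x).2
  have hpm : Monotone p := fun x y h => monotone_projIcc _ h
  have hp' : ∀ x ∈ Icc (0 : ℝ) 1, p x = x := fun x hx => by simp [p, projIcc_of_mem _ hx]
  have hT : ∀ x, r (g (p x)) ∈ insert 0 (insert 1 ((Finset.Icc (g 0) (g 1)).image r)) := by
    intro x
    refine Finset.mem_insert_of_mem (Finset.mem_insert_of_mem (Finset.mem_image_of_mem _ ?_))
    exact Finset.mem_Icc.2 ⟨hg m0 (hp x) (hp x).1, hg (hp x) m1 (hp x).2⟩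
  refine ⟨P, fun x => e ⟨r (g (p x)), hT x⟩, fun x y h => e.monotone ?_, ?_, fun x hx => ?_⟩
  · change r (g (p x)) ≤ r (g (p y))
    rcases (hg (hp x) (hp y) (hpm h)).eq_or_lt with h' | h'
    · rw [h']
    · by_contra! hlt
      have := hg (hr _) (hr _) hlt.le
      rw [hgr _ (hp x), hgr _ (hp y)] at this
      exact absurd h' (not_lt.2 this)
  · refine le_antisymm (Fin.le_last _) ?_
    obtain ⟨z, hz⟩ := e.surjective (Fin.last P.n)
    rw [← hz]
    refine e.monotone ?_
    change (z : ℝ) ≤ r (g (p 1))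
    rw [hp' 1 m1]
    simp only [r, if_true]
    rw [← hP z]
    exact (P.t_mem _).2
  · rw [hP]
    simp only [hp' x hx]
    have h := Int.abs_sub_lt_one_of_floor_eq_floor (hgr x hx).symm
    rw [← sub_div, abs_div, abs_of_pos hε, div_lt_one hε] at h
    exact h.le

lemma exists_seq_Ico_eventually {A : Set ℝ} (hA : IsLowerSet A) (h1 : (1 : ℝ) ∉ A) :
    ∃ u : ℕ → Icc (0 : ℝ) 1, ∀ x, 0 ≤ x → ∀ᶠ n in atTop, (x ∈ Ico (0 : ℝ) (u n) ↔ x ∈ A) := by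
  by_cases h0 : (0 : ℝ) ∈ A
  swap
  · exact ⟨fun _ => ⟨0, by simp⟩, fun x hx => Eventually.of_forall fun n =>
      ⟨fun h => absurd h.2 (not_lt.2 hx), fun h => absurd (hA hx h) h0⟩⟩
  have hlt : ∀ x ∈ A, x < 1 := fun x hx => by
    by_contra! h
    exact h1 (hA h hx)
  have hbdd : BddAbove A := ⟨1, fun x hx => (hlt x hx).le⟩
  have hs0 : 0 ≤ sSup A := le_csSup hbdd h0
  have hs1 : sSup A ≤ 1 := csSup_le ⟨0, h0⟩ fun x hx => (hlt x hx).le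
  by_cases hs : sSup A ∈ A
  · have hpos : ∀ n : ℕ, (0 : ℝ) < 1 / ((n : ℝ) + 1) := fun n => by positivity
    refine ⟨fun n => ⟨min 1 (sSup A + 1 / ((n : ℝ) + 1)),
      le_min zero_le_one (add_nonneg hs0 (hpos n).le), min_le_left _ _⟩, fun x hx => ?_⟩
    by_cases hxA : x ∈ A
    · refine Eventually.of_forall fun n => ⟨fun _ => hxA, fun _ => ⟨hx, lt_min (hlt x hxA) ?_⟩⟩
      linarith [le_csSup hbdd hxA, hpos n]
    · have hx' : 0 < x - sSup A := by
        by_contra! h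
        exact hxA (hA (by linarith) hs)
      filter_upwards [tendsto_one_div_add_atTop_nhds_zero_nat.eventually_lt_const hx'] with n hn
      refine ⟨fun h => ?_, fun h => absurd h hxA⟩
      have := h.2.trans_le (min_le_right _ _)
      linarith
  · refine ⟨fun _ => ⟨sSup A, hs0, hs1⟩, fun x hx => Eventually.of_forall fun n =>
      ⟨fun h => ?_, fun h => ⟨hx, (le_csSup hbdd h).lt_of_ne fun h' => hs (h' ▸ h)⟩⟩⟩
    obtain ⟨a, ha, hxa⟩ := exists_lt_of_lt_csSup ⟨0, h0⟩ h.2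
    exact hA hxa.le ha

lemma volume_restrict_real_Ico (u : Icc (0 : ℝ) 1) :
    (volume.restrict (Icc (0 : ℝ) 1)).real (Ico (0 : ℝ) u) = u := by
  rw [measureReal_restrict_apply measurableSet_Ico,
    inter_eq_left.2 (Ico_subset_Icc_self.trans (Icc_subset_Icc_right u.2.2)),
    Real.volume_real_Ico_of_le u.2.1, sub_zero]

lemma volume_restrict_unitSquare :
    (volume : Measure (ℝ × ℝ)).restrict (Icc (0 : ℝ) 1 ×ˢ Icc (0 : ℝ) 1)
      = (volume.restrict (Icc (0 : ℝ) 1)).prod (volume.restrict (Icc (0 : ℝ) 1)) := by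
  rw [Measure.prod_restrict]
  rfl

instance isProbabilityMeasure_volume_restrict_Icc :
    IsProbabilityMeasure ((volume : Measure ℝ).restrict (Icc (0 : ℝ) 1)) :=
  ⟨by simp⟩

instance isProbabilityMeasure_volume_restrict_unitSquare :
    IsProbabilityMeasure ((volume : Measure (ℝ × ℝ)).restrict (Icc (0 : ℝ) 1 ×ˢ Icc (0 : ℝ) 1)) := by
  rw [volume_restrict_unitSquare]
  infer_instance

lemma abs_real_sub_le_one {α : Type*} [MeasurableSpace α] (ρ : Measure α) [IsProbabilityMeasure ρ]
    (s : Set α) {t : ℝ} (ht0 : 0 ≤ t) (ht1 : t ≤ 1) : |(ρ s).toReal - t| ≤ 1 := by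
  have h1 : (ρ s).toReal ≤ 1 := measureReal_le_one (μ := ρ)
  have h0 : 0 ≤ (ρ s).toReal := ENNReal.toReal_nonneg
  rw [abs_le]
  constructor <;> linarith

lemma abs_real_sub_le_starDisc1 (ρ : Measure ℝ) [IsProbabilityMeasure ρ]
    (hρ : ∀ᵐ x ∂ρ, x ∈ Icc (0 : ℝ) 1) {A : Set ℝ} (hA : IsLowerSet A) (h1 : (1 : ℝ) ∉ A) :
    |ρ.real A - (volume.restrict (Icc (0 : ℝ) 1)).real A| ≤ starDisc1 ρ := by
  obtain ⟨u, hu⟩ := exists_seq_Ico_eventually hA h1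
  have hlim : ∀ μ : Measure ℝ, IsProbabilityMeasure μ → (∀ᵐ x ∂μ, x ∈ Icc (0 : ℝ) 1) →
      Tendsto (fun n => μ.real (Ico (0 : ℝ) (u n))) atTop (𝓝 (μ.real A)) := fun μ _ hμ =>
    (ENNReal.tendsto_toReal (measure_ne_top _ _)).comp <|
      tendsto_measure_of_ae_tendsto_indicator_of_isFiniteMeasure _ hA.ordConnected.measurableSet
        (fun _ => measurableSet_Ico) (hμ.mono fun x hx => hu x hx.1)
  refine le_of_tendsto' ((hlim ρ inferInstance hρ).sub
    (hlim _ inferInstance (ae_restrict_mem measurableSet_Icc))).abs fun n => ?_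
  rw [volume_restrict_real_Ico]
  refine le_ciSup (f := fun u : Icc (0 : ℝ) 1 => |(ρ (Ico (0 : ℝ) u)).toReal - u|) ⟨1, ?_⟩ (u n)
  rintro _ ⟨v, rfl⟩
  exact abs_real_sub_le_one ρ _ v.2.1 v.2.2

lemma abs_real_sub_le_starDisc2 (ρ : Measure (ℝ × ℝ)) [IsProbabilityMeasure ρ]
    (hρ : ∀ᵐ z ∂ρ, z ∈ Icc (0 : ℝ) 1 ×ˢ Icc (0 : ℝ) 1) {A B : Set ℝ} (hA : IsLowerSet A)
    (hA1 : (1 : ℝ) ∉ A) (hB : IsLowerSet B) (hB1 : (1 : ℝ) ∉ B) :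
    |ρ.real (A ×ˢ B) - (volume.restrict (Icc (0 : ℝ) 1 ×ˢ Icc (0 : ℝ) 1)).real (A ×ˢ B)|
      ≤ starDisc2 ρ := by
  obtain ⟨u, hu⟩ := exists_seq_Ico_eventually hA hA1
  obtain ⟨v, hv⟩ := exists_seq_Ico_eventually hB hB1
  have hlim : ∀ μ : Measure (ℝ × ℝ), IsProbabilityMeasure μ →
      (∀ᵐ z ∂μ, z ∈ Icc (0 : ℝ) 1 ×ˢ Icc (0 : ℝ) 1) →
      Tendsto (fun n => μ.real (Ico (0 : ℝ) (u n) ×ˢ Ico (0 : ℝ) (v n))) atTop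
        (𝓝 (μ.real (A ×ˢ B))) := fun μ _ hμ =>
    (ENNReal.tendsto_toReal (measure_ne_top _ _)).comp <|
      tendsto_measure_of_ae_tendsto_indicator_of_isFiniteMeasure _
        (hA.ordConnected.measurableSet.prod hB.ordConnected.measurableSet)
        (fun _ => measurableSet_Ico.prod measurableSet_Ico) (hμ.mono fun z hz => by
          filter_upwards [hu z.1 hz.1.1, hv z.2 hz.2.1] with n h h'
          rw [mem_prod, mem_prod, h, h'])
  refine le_of_tendsto' ((hlim ρ inferInstance hρ).sub
    (hlim _ inferInstance
      (ae_restrict_mem (measurableSet_Icc.prod measurableSet_Icc)))).abs fun n => ?_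
  rw [volume_restrict_unitSquare, measureReal_prod_prod, volume_restrict_real_Ico,
    volume_restrict_real_Ico]
  refine le_ciSup (f := fun u : Icc (0 : ℝ) 1 × Icc (0 : ℝ) 1 =>
    |(ρ (Ico (0 : ℝ) u.1 ×ˢ Ico (0 : ℝ) u.2)).toReal - u.1 * u.2|) ⟨1, ?_⟩ (u n, v n)
  rintro _ ⟨w, rfl⟩
  exact abs_real_sub_le_one ρ _ (mul_nonneg w.1.2.1 w.2.2.1)
    (mul_le_one₀ w.1.2.2 w.2.2.1 w.2.2.2)

section Step

variable {m n : ℕ} (c : Fin (m + 1) → Fin (n + 1) → ℝ) {i : ℝ → Fin (m + 1)} {j : ℝ → Fin (n + 1)}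

lemma Monotone.isLowerSet_lt {n : ℕ} {i : ℝ → Fin (n + 1)} (hi : Monotone i) (k : Fin (n + 1)) :
    IsLowerSet {x | i x < k} :=
  fun _ _ h hx => (hi h).trans_lt hx

lemma step_eq_sum_indicator (z : ℝ × ℝ) :
    c (i z.1) (j z.2) = c (Fin.last m) (Fin.last n)
      - ∑ k : Fin m, (c k.succ (Fin.last n) - c k.castSucc (Fin.last n))
          * (Prod.fst ⁻¹' {x | i x < k.succ}).indicator 1 z
      - ∑ l : Fin n, (c (Fin.last m) l.succ - c (Fin.last m) l.castSucc)
          * (Prod.snd ⁻¹' {y | j y < l.succ}).indicator 1 z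
      + ∑ k : Fin m, ∑ l : Fin n,
          (c k.succ l.succ - c k.castSucc l.succ - c k.succ l.castSucc + c k.castSucc l.castSucc)
          * ({x | i x < k.succ} ×ˢ {y | j y < l.succ}).indicator 1 z := by
  classical
  rw [abel_fin₂ c (i z.1) (j z.2)]
  simp only [indicator_apply, mem_preimage, mem_prod, mem_ofPred_eq, Pi.one_apply, ite_and,
    ite_mul, one_mul, zero_mul]

lemma integral_step (μ : Measure (ℝ × ℝ)) [IsProbabilityMeasure μ] (hi : Monotone i)
    (hj : Monotone j) :
    Integrable (fun z => c (i z.1) (j z.2)) μ ∧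
    ∫ z, c (i z.1) (j z.2) ∂μ = c (Fin.last m) (Fin.last n)
      - ∑ k : Fin m, (c k.succ (Fin.last n) - c k.castSucc (Fin.last n))
          * μ.real (Prod.fst ⁻¹' {x | i x < k.succ})
      - ∑ l : Fin n, (c (Fin.last m) l.succ - c (Fin.last m) l.castSucc)
          * μ.real (Prod.snd ⁻¹' {y | j y < l.succ})
      + ∑ k : Fin m, ∑ l : Fin n,
          (c k.succ l.succ - c k.castSucc l.succ - c k.succ l.castSucc + c k.castSucc l.castSucc)
          * μ.real ({x | i x < k.succ} ×ˢ {y | j y < l.succ}) := by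
  have mi : ∀ k, MeasurableSet {x | i x < k} := fun k =>
    (hi.isLowerSet_lt k).ordConnected.measurableSet
  have mj : ∀ k, MeasurableSet {x | j x < k} := fun k =>
    (hj.isLowerSet_lt k).ordConnected.measurableSet
  have key : ∀ (a : ℝ) {s : Set (ℝ × ℝ)}, MeasurableSet s →
      Integrable (fun z => a * s.indicator 1 z) μ := fun a s hs =>
    ((integrable_const (1 : ℝ)).indicator hs).const_mul a
  have key' : ∀ (a : ℝ) {s : Set (ℝ × ℝ)}, MeasurableSet s →
      ∫ z, a * s.indicator 1 z ∂μ = a * μ.real s := fun a s hs => by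
    rw [integral_const_mul, integral_indicator_one hs]
  have m1 : ∀ k, MeasurableSet (Prod.fst ⁻¹' {x | i x < k} : Set (ℝ × ℝ)) :=
    fun k => measurable_fst (mi k)
  have m2 : ∀ k, MeasurableSet (Prod.snd ⁻¹' {x | j x < k} : Set (ℝ × ℝ)) :=
    fun k => measurable_snd (mj k)
  have m3 : ∀ k l, MeasurableSet ({x | i x < k} ×ˢ {y | j y < l}) :=
    fun k l => (mi k).prod (mj l)
  have I1 := integrable_finsetSum Finset.univ fun (k : Fin m) _ =>
    key (c k.succ (Fin.last n) - c k.castSucc (Fin.last n)) (m1 k.succ)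
  have I2 := integrable_finsetSum Finset.univ fun (l : Fin n) _ =>
    key (c (Fin.last m) l.succ - c (Fin.last m) l.castSucc) (m2 l.succ)
  have I3' := fun (k : Fin m) => integrable_finsetSum Finset.univ fun (l : Fin n) _ => key
    (c k.succ l.succ - c k.castSucc l.succ - c k.succ l.castSucc + c k.castSucc l.castSucc)
    (m3 k.succ l.succ)
  have I3 := integrable_finsetSum Finset.univ fun (k : Fin m) _ => I3' k
  have I0 : Integrable (fun _ : ℝ × ℝ => c (Fin.last m) (Fin.last n)) μ := integrable_const _
  simp_rw [step_eq_sum_indicator c]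
  refine ⟨((I0.sub I1).sub I2).add I3, ?_⟩
  refine (integral_add ((I0.sub I1).sub I2) I3).trans ?_
  rw [integral_sub' (I0.sub I1) I2, integral_sub' I0 I1,
    integral_finsetSum _ fun k _ => key _ (m1 k.succ),
    integral_finsetSum _ fun k _ => key _ (m2 k.succ), integral_finsetSum _ fun k _ => I3' k]
  simp_rw [integral_finsetSum _ fun l _ => key _ (m3 _ (Fin.succ l))]
  simp only [key' _ (m1 _), key' _ (m2 _), key' _ (m3 _ _), integral_const, probReal_univ, one_smul]

end Step

lemma abs_sum_mul_le {ι : Type*} [Fintype ι] (a b : ι → ℝ) {S D : ℝ} (ha : ∑ k, |a k| ≤ S)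
    (hb : ∀ k, |b k| ≤ D) (hD : 0 ≤ D) : |∑ k, a k * b k| ≤ S * D := by
  calc |∑ k, a k * b k| ≤ ∑ k, |a k * b k| := Finset.abs_sum_le_sum_abs _ _
    _ ≤ ∑ k, |a k| * D := Finset.sum_le_sum fun k _ => by
        rw [abs_mul]
        exact mul_le_mul_of_nonneg_left (hb k) (abs_nonneg _)
    _ = (∑ k, |a k|) * D := (Finset.sum_mul _ _ _).symm
    _ ≤ S * D := mul_le_mul_of_nonneg_right ha hD

lemma abs_integral_step_sub_le (f : ℝ → ℝ → ℝ)
    (h1 : BddAbove (range (bvSum (fun x => f x 1))))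
    (h2 : BddAbove (range (bvSum (fun y => f 1 y))))
    (h5 : BddAbove (range (fun PQ : Partition01 × Partition01 => vitaliSum f PQ.1 PQ.2)))
    (ν : Measure (ℝ × ℝ)) [IsProbabilityMeasure ν]
    (hν : ∀ᵐ z ∂ν, z ∈ Icc (0 : ℝ) 1 ×ˢ Icc (0 : ℝ) 1)
    (P Q : Partition01) {i : ℝ → Fin (P.n + 1)} {j : ℝ → Fin (Q.n + 1)} (hi : Monotone i)
    (hj : Monotone j) (hi1 : i 1 = Fin.last P.n) (hj1 : j 1 = Fin.last Q.n) :
    |(∫ z, f (P.t (i z.1)) (Q.t (j z.2)) ∂ν)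
        - ∫ z in (Icc (0 : ℝ) 1 ×ˢ Icc (0 : ℝ) 1), f (P.t (i z.1)) (Q.t (j z.2))|
      ≤ bvNorm (fun x => f x 1) * starDisc1 (ν.map Prod.fst)
        + bvNorm (fun y => f 1 y) * starDisc1 (ν.map Prod.snd)
        + vitaliVar f * starDisc2 ν := by
  set lam := (volume : Measure (ℝ × ℝ)).restrict (Icc (0 : ℝ) 1 ×ˢ Icc (0 : ℝ) 1) with hlam
  have n1 : ∀ k : Fin P.n, (1 : ℝ) ∉ {x | i x < k.succ} := fun k h =>
    absurd (h.trans_le (Fin.le_last _)) (by simp [hi1])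
  have n2 : ∀ k : Fin Q.n, (1 : ℝ) ∉ {x | j x < k.succ} := fun k h =>
    absurd (h.trans_le (Fin.le_last _)) (by simp [hj1])
  have p1 : IsProbabilityMeasure (ν.map Prod.fst) :=
    Measure.isProbabilityMeasure_map measurable_fst.aemeasurable
  have p2 : IsProbabilityMeasure (ν.map Prod.snd) :=
    Measure.isProbabilityMeasure_map measurable_snd.aemeasurable
  have d1 : ∀ k : Fin P.n, |ν.real (Prod.fst ⁻¹' {x | i x < k.succ})
      - lam.real (Prod.fst ⁻¹' {x | i x < k.succ})| ≤ starDisc1 (ν.map Prod.fst) := fun k => by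
    have mA := (hi.isLowerSet_lt k.succ).ordConnected.measurableSet
    have h := abs_real_sub_le_starDisc1 (ν.map Prod.fst)
      ((ae_map_iff measurable_fst.aemeasurable measurableSet_Icc).2 (hν.mono fun z hz => hz.1))
      (hi.isLowerSet_lt k.succ) (n1 k)
    have hl : lam.map Prod.fst = volume.restrict (Icc (0 : ℝ) 1) := by
      rw [hlam, volume_restrict_unitSquare, Measure.map_fst_prod, measure_univ, one_smul]
    rwa [← hl, map_measureReal_apply measurable_fst mA,
      map_measureReal_apply measurable_fst mA] at h
  have d2 : ∀ k : Fin Q.n, |ν.real (Prod.snd ⁻¹' {x | j x < k.succ})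
      - lam.real (Prod.snd ⁻¹' {x | j x < k.succ})| ≤ starDisc1 (ν.map Prod.snd) := fun k => by
    have mA := (hj.isLowerSet_lt k.succ).ordConnected.measurableSet
    have h := abs_real_sub_le_starDisc1 (ν.map Prod.snd)
      ((ae_map_iff measurable_snd.aemeasurable measurableSet_Icc).2 (hν.mono fun z hz => hz.2))
      (hj.isLowerSet_lt k.succ) (n2 k)
    have hl : lam.map Prod.snd = volume.restrict (Icc (0 : ℝ) 1) := by
      rw [hlam, volume_restrict_unitSquare, Measure.map_snd_prod, measure_univ, one_smul]
    rwa [← hl, map_measureReal_apply measurable_snd mA,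
      map_measureReal_apply measurable_snd mA] at h
  have d3 : ∀ kl : Fin P.n × Fin Q.n, |ν.real ({x | i x < kl.1.succ} ×ˢ {y | j y < kl.2.succ})
      - lam.real ({x | i x < kl.1.succ} ×ˢ {y | j y < kl.2.succ})| ≤ starDisc2 ν := fun kl =>
    abs_real_sub_le_starDisc2 ν hν (hi.isLowerSet_lt _) (n1 _) (hj.isLowerSet_lt _) (n2 _)
  have D1 : ∀ ρ : Measure ℝ, 0 ≤ starDisc1 ρ := fun ρ => Real.iSup_nonneg fun _ => abs_nonneg _
  have D2 : 0 ≤ starDisc2 ν := Real.iSup_nonneg fun _ => abs_nonneg _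
  have s1 : ∑ k : Fin P.n, |f (P.t k.succ) 1 - f (P.t k.castSucc) 1| ≤ bvNorm (fun x => f x 1) :=
    le_ciSup h1 P
  have s2 : ∑ l : Fin Q.n, |f 1 (Q.t l.succ) - f 1 (Q.t l.castSucc)| ≤ bvNorm (fun y => f 1 y) :=
    le_ciSup h2 Q
  have s3 : ∑ kl : Fin P.n × Fin Q.n, |f (P.t kl.1.succ) (Q.t kl.2.succ)
      - f (P.t kl.1.castSucc) (Q.t kl.2.succ) - f (P.t kl.1.succ) (Q.t kl.2.castSucc)
      + f (P.t kl.1.castSucc) (Q.t kl.2.castSucc)| ≤ vitaliVar f := by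
    rw [Fintype.sum_prod_type]
    exact le_ciSup h5 (P, Q)
  have b1 := abs_sum_mul_le _ _ s1 d1 (D1 _)
  have b2 := abs_sum_mul_le _ _ s2 d2 (D1 _)
  have b3 := abs_sum_mul_le _ _ s3 d3 D2
  rw [(integral_step (fun k l => f (P.t k) (Q.t l)) ν hi hj).2,
    (integral_step (fun k l => f (P.t k) (Q.t l)) lam hi hj).2, P.last, Q.last]
  rw [Fintype.sum_prod_type] at b3
  simp only [mul_sub, Finset.sum_sub_distrib] at b1 b2 b3
  rw [abs_le] at b1 b2 b3 ⊢
  constructor <;> linarith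

lemma abs_integral_sub_le_of_ae {f g : ℝ × ℝ → ℝ} (μ : Measure (ℝ × ℝ))
    [IsProbabilityMeasure μ] (hf : AEStronglyMeasurable f μ) (hg : Integrable g μ) {ε : ℝ}
    (h : ∀ᵐ z ∂μ, |f z - g z| ≤ ε) :
    |∫ z, f z ∂μ - ∫ z, g z ∂μ| ≤ ε := by
  have hd : Integrable (fun z => f z - g z) μ :=
    Integrable.of_bound (hf.sub hg.aestronglyMeasurable) ε h
  have hfi : Integrable f μ := (hd.add hg).congr (Eventually.of_forall fun z => by simp)
  rw [← integral_sub hfi hg]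
  have h' : ∀ᵐ z ∂μ, ‖f z - g z‖ ≤ ε := h
  simpa using norm_integral_le_of_norm_le_const h'

lemma exists_step_approx (f : ℝ → ℝ → ℝ)
    (h3 : BddAbove (range (bvSum (fun x => f x 0))))
    (h4 : BddAbove (range (bvSum (fun y => f 0 y))))
    (h5 : BddAbove (range (fun PQ : Partition01 × Partition01 => vitaliSum f PQ.1 PQ.2)))
    {ε : ℝ} (hε : 0 < ε) :
    ∃ P Q : Partition01, ∃ i : ℝ → Fin (P.n + 1), ∃ j : ℝ → Fin (Q.n + 1),
      Monotone i ∧ Monotone j ∧ i 1 = Fin.last P.n ∧ j 1 = Fin.last Q.n ∧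
      ∀ z ∈ Icc (0 : ℝ) 1 ×ˢ Icc (0 : ℝ) 1,
        |f z.1 z.2 - f (P.t (i z.1)) (Q.t (j z.2))| ≤ ε := by
  obtain ⟨F, hF, hfF⟩ := exists_monotone_control f h3 h5
  obtain ⟨G, hG, hfG⟩ := exists_monotone_control (fun y x => f x y) h4 (by
    obtain ⟨B, hB⟩ := h5
    refine ⟨B, ?_⟩
    rintro _ ⟨⟨P, Q⟩, rfl⟩
    refine le_trans (le_of_eq ?_) (hB ⟨(Q, P), rfl⟩)
    simp only [vitaliSum]
    rw [Finset.sum_comm]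
    refine Finset.sum_congr rfl fun _ _ => Finset.sum_congr rfl fun _ _ => ?_
    congr 1
    ring)
  obtain ⟨P, i, hi, hi1, hiF⟩ := exists_partition_approx F hF (half_pos hε)
  obtain ⟨Q, j, hj, hj1, hjG⟩ := exists_partition_approx G hG (half_pos hε)
  refine ⟨P, Q, i, j, hi, hj, hi1, hj1, fun z hz => ?_⟩
  have e1 := (hfF z.1 hz.1 (P.t (i z.1)) (P.t_mem _) z.2 hz.2).trans (hiF _ hz.1)
  have e2 := (hfG z.2 hz.2 (Q.t (j z.2)) (Q.t_mem _) _ (P.t_mem (i z.1))).trans (hjG _ hz.2)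
  linarith [abs_sub_le (f z.1 z.2) (f (P.t (i z.1)) z.2) (f (P.t (i z.1)) (Q.t (j z.2)))]

/-- Koksma–Hlawka inequality for measures:
`|∫ f dν − ∫_{[0,1]²} f dx| ≤ ‖f(·,1)‖_BV D*(ν₁) + ‖f(1,·)‖_BV D*(ν₂) + V²(f) D*(ν)`. -/
theorem koksma_hlawka_for_measures
    (f : ℝ → ℝ → ℝ)
    (h1 : BddAbove (Set.range (bvSum (fun x => f x 1))))
    (h2 : BddAbove (Set.range (bvSum (fun y => f 1 y))))
    (h3 : BddAbove (Set.range (bvSum (fun x => f x 0))))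
    (h4 : BddAbove (Set.range (bvSum (fun y => f 0 y))))
    (h5 : BddAbove (Set.range (fun PQ : Partition01 × Partition01 => vitaliSum f PQ.1 PQ.2)))
    (ν : Measure (ℝ × ℝ)) [IsProbabilityMeasure ν]
    (hsupp : ν (Set.Icc (0:ℝ) 1 ×ˢ Set.Icc (0:ℝ) 1) = 1) :
    |(∫ z, f z.1 z.2 ∂ν) - ∫ z in (Set.Icc (0:ℝ) 1 ×ˢ Set.Icc (0:ℝ) 1), f z.1 z.2|
      ≤ bvNorm (fun x => f x 1) * starDisc1 (ν.map Prod.fst)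
        + bvNorm (fun y => f 1 y) * starDisc1 (ν.map Prod.snd)
        + vitaliVar f * starDisc2 ν := by
  have hν : ∀ᵐ z ∂ν, z ∈ Icc (0 : ℝ) 1 ×ˢ Icc (0 : ℝ) 1 :=
    (prob_compl_eq_zero_iff (measurableSet_Icc.prod measurableSet_Icc)).2 hsupp
  have hmeas : ∀ μ : Measure (ℝ × ℝ), IsProbabilityMeasure μ →
      (∀ᵐ z ∂μ, z ∈ Icc (0 : ℝ) 1 ×ˢ Icc (0 : ℝ) 1) →
      AEStronglyMeasurable (fun z => f z.1 z.2) μ := by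
    intro μ _ hμ
    have hpos : ∀ n : ℕ, (0 : ℝ) < 1 / ((n : ℝ) + 1) := fun n => by positivity
    choose P Q i j hi hj _ _ hf using fun n : ℕ => exists_step_approx f h3 h4 h5 (hpos n)
    refine aestronglyMeasurable_of_tendsto_ae atTop
      (f := fun n z => f ((P n).t (i n z.1)) ((Q n).t (j n z.2)))
      (fun n => (integral_step (fun k l => f ((P n).t k) ((Q n).t l)) μ (hi n)
        (hj n)).1.aestronglyMeasurable) ?_
    filter_upwards [hμ] with z hz
    rw [tendsto_iff_dist_tendsto_zero]
    refine squeeze_zero (fun _ => dist_nonneg) (fun n => ?_)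
      tendsto_one_div_add_atTop_nhds_zero_nat
    rw [dist_comm]
    exact hf n z hz
  have hvol := ae_restrict_mem (μ := (volume : Measure (ℝ × ℝ)))
    ((measurableSet_Icc (a := (0 : ℝ)) (b := 1)).prod (measurableSet_Icc (a := (0 : ℝ)) (b := 1)))
  refine le_of_forall_pos_le_add fun ε hε => ?_
  obtain ⟨P, Q, i, j, hi, hj, hi1, hj1, hf⟩ := exists_step_approx f h3 h4 h5 (half_pos hε)
  have hs := abs_integral_step_sub_le f h1 h2 h5 ν hν P Q hi hj hi1 hj1
  have e1 := abs_integral_sub_le_of_ae ν (hmeas ν inferInstance hν)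
    (integral_step (fun k l => f (P.t k) (Q.t l)) ν hi hj).1 (hν.mono hf)
  have e2 := abs_integral_sub_le_of_ae _ (hmeas _ inferInstance hvol)
    (integral_step (fun k l => f (P.t k) (Q.t l)) _ hi hj).1 (hvol.mono hf)
  rw [abs_le] at hs e1 e2 ⊢
  constructor <;> linarith
end

section
/- Let f : ℝ² → ℝ be differentiable with f and both partial derivatives Lipschitz, and set ‖f‖_{C^{1,1}} = max( Lip(f), Lip(∂f/∂x), Lip(∂f/∂y) ), where Lip(g) = sup_{u≠v} |g(u)−g(v)|/‖u−v‖. Let ψ : [0,1] → ℝ have ‖ψ‖_{BV([0,1])} < ∞. Then: (i) for every c ∈ [0,1], ‖x ↦ f(ψ(x), ψ(c))‖_{BV([0,1])} ≤ ‖f‖_{C^{1,1}} ‖ψ‖_{BV([0,1])} and ‖x ↦ f(ψ(c), ψ(x))‖_{BV([0,1])} ≤ ‖f‖_{C^{1,1}} ‖ψ‖_{BV([0,1])}; and (ii) the Vitali variation satisfies V²( (x,y) ↦ f(ψ(x), ψ(y)) ) ≤ ‖f‖_{C^{1,1}} ‖ψ‖²_{BV([0,1])}. -/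
open MeasureTheory

/-- Lipschitz seminorm `Lip(g) = sup_{u ≠ v} |g(u) − g(v)| / ‖u − v‖` (Euclidean norm). -/
noncomputable def lipSemi (g : ℝ × ℝ → ℝ) : ℝ :=
  ⨆ p : {q : (ℝ × ℝ) × (ℝ × ℝ) // q.1 ≠ q.2},
    |g p.val.1 - g p.val.2| /
      Real.sqrt ((p.val.1.1 - p.val.2.1) ^ 2 + (p.val.1.2 - p.val.2.2) ^ 2)

/-- The `C^{1,1}` seminorm `max(Lip f, Lip ∂f/∂x, Lip ∂f/∂y)`. -/
noncomputable def c11Semi (f : ℝ × ℝ → ℝ) : ℝ :=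
  max (lipSemi f)
    (max (lipSemi (fun z => fderiv ℝ f z (1, 0)))
      (lipSemi (fun z => fderiv ℝ f z (0, 1))))

theorem Partition01.nonempty : Nonempty Partition01 :=
  ⟨{ n := 1
     t := fun i => (i : ℝ)
     mono := fun i j h => Nat.cast_le.2 (Fin.le_def.1 h)
     first := by simp
     last := by simp }⟩

theorem bvSum_nonneg (g : ℝ → ℝ) (P : Partition01) : 0 ≤ bvSum g P :=
  Finset.sum_nonneg fun _ _ => abs_nonneg _

theorem bvNorm_nonneg (g : ℝ → ℝ) : 0 ≤ bvNorm g :=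
  Real.iSup_nonneg (bvSum_nonneg g)

theorem lipSemi_nonneg (g : ℝ × ℝ → ℝ) : 0 ≤ lipSemi g :=
  Real.iSup_nonneg fun _ => by positivity

theorem c11Semi_nonneg (f : ℝ × ℝ → ℝ) : 0 ≤ c11Semi f :=
  (lipSemi_nonneg f).trans (le_max_left _ _)

theorem abs_sub_le_lipSemi_mul (g : ℝ × ℝ → ℝ)
    (hg : BddAbove (Set.range (fun p : {q : (ℝ × ℝ) × (ℝ × ℝ) // q.1 ≠ q.2} =>
      |g p.val.1 - g p.val.2| /
        Real.sqrt ((p.val.1.1 - p.val.2.1) ^ 2 + (p.val.1.2 - p.val.2.2) ^ 2))))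
    (u v : ℝ × ℝ) :
    |g u - g v| ≤ lipSemi g * Real.sqrt ((u.1 - v.1) ^ 2 + (u.2 - v.2) ^ 2) := by
  by_cases h : u = v
  · simp [h]
  · have hpos : 0 < (u.1 - v.1) ^ 2 + (u.2 - v.2) ^ 2 := by
      by_contra! hle
      refine h (Prod.ext ?_ ?_) <;> nlinarith [sq_nonneg (u.1 - v.1), sq_nonneg (u.2 - v.2)]
    exact (div_le_iff₀ (Real.sqrt_pos.2 hpos)).1 (le_ciSup hg ⟨(u, v), h⟩)

/-- The mixed second difference of `f` is controlled by the Lipschitz seminorm of `∂f/∂x`. -/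
theorem abs_mixed_diff_le (f : ℝ × ℝ → ℝ) (hf : Differentiable ℝ f)
    (hLfx : BddAbove (Set.range (fun p : {q : (ℝ × ℝ) × (ℝ × ℝ) // q.1 ≠ q.2} =>
      |fderiv ℝ f p.val.1 (1, 0) - fderiv ℝ f p.val.2 (1, 0)| /
        Real.sqrt ((p.val.1.1 - p.val.2.1) ^ 2 + (p.val.1.2 - p.val.2.2) ^ 2))))
    (a a' b b' : ℝ) :
    |f (a', b') - f (a, b') - f (a', b) + f (a, b)| ≤
      lipSemi (fun z => fderiv ℝ f z (1, 0)) * (|a' - a| * |b' - b|) := by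
  have hderiv (c x : ℝ) : HasDerivAt (fun x => f (x, c)) (fderiv ℝ f (x, c) (1, 0)) x :=
    (hf (x, c)).hasFDerivAt.comp_hasDerivAt x ((hasDerivAt_id x).prodMk (hasDerivAt_const x c))
  have h := Convex.norm_image_sub_le_of_norm_hasDerivWithin_le
    (C := lipSemi (fun z => fderiv ℝ f z (1, 0)) * |b' - b|)
    (fun x _ => ((hderiv b' x).sub (hderiv b x)).hasDerivWithinAt)
    (fun x _ => by
      simpa [Real.sqrt_sq_eq_abs] using
        abs_sub_le_lipSemi_mul (fun z => fderiv ℝ f z (1, 0)) hLfx (x, b') (x, b))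
    convex_univ (Set.mem_univ a) (Set.mem_univ a')
  calc _ = ‖f (a', b') - f (a', b) - (f (a, b') - f (a, b))‖ := by
        rw [Real.norm_eq_abs]; congr 1; ring
    _ ≤ _ := h
    _ = _ := by rw [Real.norm_eq_abs]; ring

theorem bvNorm_comp_le {g ψ : ℝ → ℝ} {L : ℝ} (hL : 0 ≤ L)
    (hψ : BddAbove (Set.range (bvSum ψ))) (hg : ∀ a b, |g a - g b| ≤ L * |a - b|) :
    bvNorm (fun x => g (ψ x)) ≤ L * bvNorm ψ := by
  have := Partition01.nonempty
  refine ciSup_le fun P => le_trans ?_ (mul_le_mul_of_nonneg_left (le_ciSup hψ P) hL)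
  rw [bvSum, bvSum, Finset.mul_sum]
  exact Finset.sum_le_sum fun i _ => hg _ _

theorem vitaliVar_comp_le {F : ℝ → ℝ → ℝ} {ψ : ℝ → ℝ} {L : ℝ} (hL : 0 ≤ L)
    (hψ : BddAbove (Set.range (bvSum ψ)))
    (hF : ∀ a a' b b', |F a' b' - F a b' - F a' b + F a b| ≤ L * (|a' - a| * |b' - b|)) :
    vitaliVar (fun x y => F (ψ x) (ψ y)) ≤ L * bvNorm ψ ^ 2 := by
  have := Partition01.nonempty
  refine ciSup_le fun PQ => ?_
  calc vitaliSum (fun x y => F (ψ x) (ψ y)) PQ.1 PQ.2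
      ≤ L * (bvSum ψ PQ.1 * bvSum ψ PQ.2) := by
        rw [bvSum, bvSum, Finset.sum_mul_sum, Finset.mul_sum]
        refine Finset.sum_le_sum fun i _ => ?_
        rw [Finset.mul_sum]
        exact Finset.sum_le_sum fun j _ => hF _ _ _ _
    _ ≤ L * bvNorm ψ ^ 2 := by
        rw [sq]
        exact mul_le_mul_of_nonneg_left (mul_le_mul (le_ciSup hψ _) (le_ciSup hψ _)
          (bvSum_nonneg _ _) (bvNorm_nonneg _)) hL

/-- if `f : ℝ² → ℝ` is differentiable with `f` and both partials Lipschitz,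
and `ψ` has bounded variation on `[0,1]`, then (i) sections `x ↦ f(ψ(x), ψ(c))` and
`x ↦ f(ψ(c), ψ(x))` have BV norm at most `‖f‖_{C^{1,1}} ‖ψ‖_BV`, and (ii) the Vitali
variation of `(x,y) ↦ f(ψ(x), ψ(y))` is at most `‖f‖_{C^{1,1}} ‖ψ‖_BV²`. -/
theorem composition_bv_bounds
    (f : ℝ × ℝ → ℝ) (hdiff : Differentiable ℝ f)
    (hLf : BddAbove (Set.range (fun p : {q : (ℝ × ℝ) × (ℝ × ℝ) // q.1 ≠ q.2} =>
      |f p.val.1 - f p.val.2| /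
        Real.sqrt ((p.val.1.1 - p.val.2.1) ^ 2 + (p.val.1.2 - p.val.2.2) ^ 2))))
    (hLfx : BddAbove (Set.range (fun p : {q : (ℝ × ℝ) × (ℝ × ℝ) // q.1 ≠ q.2} =>
      |fderiv ℝ f p.val.1 (1, 0) - fderiv ℝ f p.val.2 (1, 0)| /
        Real.sqrt ((p.val.1.1 - p.val.2.1) ^ 2 + (p.val.1.2 - p.val.2.2) ^ 2))))
    (hLfy : BddAbove (Set.range (fun p : {q : (ℝ × ℝ) × (ℝ × ℝ) // q.1 ≠ q.2} =>
      |fderiv ℝ f p.val.1 (0, 1) - fderiv ℝ f p.val.2 (0, 1)| /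
        Real.sqrt ((p.val.1.1 - p.val.2.1) ^ 2 + (p.val.1.2 - p.val.2.2) ^ 2))))
    (ψ : ℝ → ℝ) (hψ : BddAbove (Set.range (bvSum ψ))) :
    (∀ c ∈ Set.Icc (0:ℝ) 1,
        bvNorm (fun x => f (ψ x, ψ c)) ≤ c11Semi f * bvNorm ψ ∧
        bvNorm (fun x => f (ψ c, ψ x)) ≤ c11Semi f * bvNorm ψ) ∧
      vitaliVar (fun x y => f (ψ x, ψ y)) ≤ c11Semi f * bvNorm ψ ^ 2 := by
  have hlip (u v : ℝ × ℝ) :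
      |f u - f v| ≤ c11Semi f * Real.sqrt ((u.1 - v.1) ^ 2 + (u.2 - v.2) ^ 2) :=
    (abs_sub_le_lipSemi_mul f hLf u v).trans
      (mul_le_mul_of_nonneg_right (le_max_left _ _) (Real.sqrt_nonneg _))
  refine ⟨fun c _ => ⟨?_, ?_⟩, ?_⟩
  · exact bvNorm_comp_le (g := fun a => f (a, ψ c)) (c11Semi_nonneg f) hψ fun a b => by
      simpa [Real.sqrt_sq_eq_abs] using hlip (a, ψ c) (b, ψ c)
  · exact bvNorm_comp_le (g := fun a => f (ψ c, a)) (c11Semi_nonneg f) hψ fun a b => by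
      simpa [Real.sqrt_sq_eq_abs] using hlip (ψ c, a) (ψ c, b)
  · exact vitaliVar_comp_le (F := fun a b => f (a, b)) (c11Semi_nonneg f) hψ fun a a' b b' =>
      (abs_mixed_diff_le f hdiff hLfx a a' b b').trans
        (mul_le_mul_of_nonneg_right ((le_max_left _ _).trans (le_max_right _ _)) (by positivity))
end
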